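/- arXiv:1901.08371 — 2 statements merged into one kernel-verified Lean document; each statement's English description precedes it below -/
import Mathlib

section
/- Let q be a prime, G a commutative group of order q, and h, h₁, …, h_N ∈ G. Suppose c₁,…,c_N, t₃ ∈ G, u ∈ (ZMod q)^N, and c, c*, s₃, s₃* ∈ ZMod q, s', s'* ∈ (ZMod q)^N satisfy c ≠ c*, t₃ = (∏_{i=1}^N c_i^{u_i})^{-c} h^{s₃} ∏_{i=1}^N h_i^{s'_i} and t₃ = (∏_{i=1}^N c_i^{u_i})^{-c*} h^{s₃*} ∏_{i=1}^N h_i^{s'^*_i}. Then ∏_{j=1}^N c_j^{u_j} = EPC(u', r̃) where u' = (s'-s'*)/(c-c*) ∈ (ZMod q)^N and r̃ = (s₃-s₃*)/(c-c*). -/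
/-- Exponentiation of a monoid element by an element of `ZMod n`. -/
instance (priority := low) monoidZModPow {M : Type*} [Monoid M] {n : ℕ} :
    Pow M (ZMod n) := ⟨fun g x => g ^ x.val⟩

/-- The extended Pedersen commitment `EPC(m, r) = h^r ∏ i, hᵢ^(mᵢ)`. -/
def EPC {G : Type*} [CommGroup G] {q N : ℕ} (h : G) (hs : Fin N → G)
    (m : Fin N → ZMod q) (r : ZMod q) : G :=
  h ^ r * ∏ i, hs i ^ m i

section ZModPow

variable {q : ℕ} [Fact (Nat.Prime q)] {G : Type*} [CommGroup G] [Fintype G]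

theorem pow_zmod_natCast (hcard : Fintype.card G = q) (g : G) (n : ℕ) :
    g ^ (n : ZMod q) = g ^ n := by
  change g ^ (n : ZMod q).val = g ^ n
  rw [ZMod.val_natCast, ← hcard, pow_mod_card]

theorem pow_zmod_add (hcard : Fintype.card G = q) (g : G) (x y : ZMod q) :
    g ^ (x + y) = g ^ x * g ^ y := by
  obtain ⟨m, rfl⟩ := ZMod.natCast_zmod_surjective x
  obtain ⟨n, rfl⟩ := ZMod.natCast_zmod_surjective y
  rw [← Nat.cast_add]
  simp only [pow_zmod_natCast hcard, pow_add]

theorem pow_zmod_mul (hcard : Fintype.card G = q) (g : G) (x y : ZMod q) :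
    g ^ (x * y) = (g ^ x) ^ y := by
  obtain ⟨m, rfl⟩ := ZMod.natCast_zmod_surjective x
  obtain ⟨n, rfl⟩ := ZMod.natCast_zmod_surjective y
  rw [← Nat.cast_mul]
  simp only [pow_zmod_natCast hcard, pow_mul]

theorem pow_zmod_one (hcard : Fintype.card G = q) (g : G) : g ^ (1 : ZMod q) = g := by
  simpa using pow_zmod_natCast hcard g 1

theorem pow_zmod_neg (hcard : Fintype.card G = q) (g : G) (x : ZMod q) :
    g ^ (-x) = (g ^ x)⁻¹ := by
  rw [eq_inv_iff_mul_eq_one, ← pow_zmod_add hcard, neg_add_cancel]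
  simpa using pow_zmod_natCast hcard g 0

theorem pow_zmod_sub (hcard : Fintype.card G = q) (g : G) (x y : ZMod q) :
    g ^ (x - y) = g ^ x / g ^ y := by
  rw [sub_eq_add_neg, pow_zmod_add hcard, pow_zmod_neg hcard, div_eq_mul_inv]

theorem EPC_sub (hcard : Fintype.card G = q) {N : ℕ} (h : G) (hs : Fin N → G)
    (m m' : Fin N → ZMod q) (r r' : ZMod q) :
    EPC h hs (m - m') (r - r') = EPC h hs m r / EPC h hs m' r' := by
  simp only [EPC, Pi.sub_apply, pow_zmod_sub hcard, Finset.prod_div_distrib, mul_div_mul_comm]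

theorem EPC_pow (hcard : Fintype.card G = q) {N : ℕ} (h : G) (hs : Fin N → G)
    (m : Fin N → ZMod q) (r x : ZMod q) :
    EPC h hs m r ^ x = EPC h hs (fun i => m i * x) (r * x) := by
  simp only [EPC, pow_zmod_mul hcard]
  change (h ^ r * ∏ i, hs i ^ m i) ^ x.val = (h ^ r) ^ x.val * ∏ i, (hs i ^ m i) ^ x.val
  rw [mul_pow, Finset.prod_pow]

end ZModPow

theorem stmt_8 {q : ℕ} [Fact (Nat.Prime q)] {G : Type*} [CommGroup G] [Fintype G]
    (hcard : Fintype.card G = q) {N : ℕ} (h : G) (hs : Fin N → G)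
    (cvec : Fin N → G) (t₃ : G) (u : Fin N → ZMod q)
    (c cstar s₃ s₃star : ZMod q) (s' s'star : Fin N → ZMod q)
    (hne : c ≠ cstar)
    (h1 : t₃ = (∏ i, cvec i ^ u i) ^ (-c) * h ^ s₃ * ∏ i, hs i ^ s' i)
    (h2 : t₃ = (∏ i, cvec i ^ u i) ^ (-cstar) * h ^ s₃star * ∏ i, hs i ^ s'star i) :
    ∏ j, cvec j ^ u j =
      EPC h hs (fun i => (s' i - s'star i) / (c - cstar)) ((s₃ - s₃star) / (c - cstar)) := by
  set P := ∏ j, cvec j ^ u j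
  have e1 : EPC h hs s' s₃ = t₃ * P ^ c := by
    rw [h1, pow_zmod_neg hcard, EPC, mul_assoc (P ^ c)⁻¹, mul_right_comm, inv_mul_cancel,
      one_mul]
  have e2 : EPC h hs s'star s₃star = t₃ * P ^ cstar := by
    rw [h2, pow_zmod_neg hcard, EPC, mul_assoc (P ^ cstar)⁻¹, mul_right_comm, inv_mul_cancel,
      one_mul]
  have key : P ^ (c - cstar) = EPC h hs (s' - s'star) (s₃ - s₃star) := by
    rw [EPC_sub hcard, e1, e2, mul_div_mul_left_eq_div, pow_zmod_sub hcard]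
  calc P = (P ^ (c - cstar)) ^ (c - cstar)⁻¹ := by
        rw [← pow_zmod_mul hcard, mul_inv_cancel₀ (sub_ne_zero.mpr hne), pow_zmod_one hcard]
    _ = _ := by
        rw [key, EPC_pow hcard]
        simp only [Pi.sub_apply, div_eq_mul_inv]
end

section
/- Let q be a prime, G a commutative group of order q, g, pk ∈ G, and Enc(m,r) = (g^r, pk^r m) ∈ G×G, extended componentwise to width-w vectors, with ReEnc(e,r) = e·Enc(1,r). Suppose e_1,…,e_N, e'_1,…,e'_N ∈ (G×G)^w, t₄ ∈ (G×G)^w, u ∈ (ZMod q)^N, and c, c* ∈ ZMod q, s', s'* ∈ (ZMod q)^N, s₄, s₄* ∈ (ZMod q)^w satisfy c ≠ c*, t₄ = ReEnc((∏_{i=1}^N e_i^{u_i})^{-c} ∏_{i=1}^N (e'_i)^{s'_i}, -s₄) and t₄ = ReEnc((∏_{i=1}^N e_i^{u_i})^{-c*} ∏_{i=1}^N (e'_i)^{s'^*_i}, -s₄*). Then, with u' = (s'-s'*)/(c-c*) and r⋆ = (s₄-s₄*)/(c-c*), we have ∏_{i=1}^N (e'_i)^{u'_i} = Enc(1, r⋆)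 · ∏_{i=1}^N e_i^{u_i}. -/
/-- Componentwise ElGamal encryption of a width-`w` vector of messages. -/
def EncV {G : Type*} [CommGroup G] {q w : ℕ} (g pk : G)
    (m : Fin w → G) (r : Fin w → ZMod q) : Fin w → G × G :=
  fun k => (g ^ r k, pk ^ r k * m k)

/-- Componentwise re-encryption: `ReEnc(e, r) = e · Enc(1, r)`. -/
def ReEncV {G : Type*} [CommGroup G] {q w : ℕ} (g pk : G)
    (e : Fin w → G × G) (r : Fin w → ZMod q) : Fin w → G × G :=
  e * EncV g pk 1 r

section ZModPow

variable {q : ℕ} {G : Type*} [CommGroup G]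

theorem zmod_pow_def {M : Type*} [Monoid M] {n : ℕ} (a : M) (x : ZMod n) :
    a ^ x = a ^ x.val := rfl

theorem pow_mod_of_card_eq [Fintype G] (hcard : Fintype.card G = q) (a : G) (n : ℕ) :
    a ^ (n % q) = a ^ n := by
  rw [← hcard, pow_mod_card]

theorem zmod_pow_add [Fact (Nat.Prime q)] [Fintype G]
    (hcard : Fintype.card G = q) (a : G) (x y : ZMod q) :
    a ^ (x + y) = a ^ x * a ^ y := by
  simp only [zmod_pow_def, ZMod.val_add, pow_mod_of_card_eq hcard, pow_add]

theorem zmod_pow_mul [Fact (Nat.Prime q)] [Fintype G]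
    (hcard : Fintype.card G = q) (a : G) (x y : ZMod q) :
    a ^ (x * y) = (a ^ x) ^ y := by
  simp only [zmod_pow_def, ZMod.val_mul, pow_mod_of_card_eq hcard, pow_mul]

theorem zmod_pow_zero [NeZero q] (a : G) : a ^ (0 : ZMod q) = 1 := by
  simp [zmod_pow_def]

theorem zmod_pow_one [Fact (Nat.Prime q)] (a : G) : a ^ (1 : ZMod q) = a := by
  simp [zmod_pow_def, ZMod.val_one]

theorem zmod_mul_pow (a b : G) (x : ZMod q) : (a * b) ^ x = a ^ x * b ^ x := by
  simp only [zmod_pow_def, mul_pow]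

theorem zmod_prod_pow {ι : Type*} [Fintype ι] (f : ι → G) (x : ZMod q) :
    (∏ i, f i) ^ x = ∏ i, f i ^ x := by
  simp only [zmod_pow_def, Finset.prod_pow]

theorem zmod_pow_neg [Fact (Nat.Prime q)] [Fintype G]
    (hcard : Fintype.card G = q) (a : G) (x : ZMod q) :
    a ^ (-x) = (a ^ x)⁻¹ := by
  rw [eq_inv_iff_mul_eq_one, ← zmod_pow_add hcard, neg_add_cancel, zmod_pow_zero]

theorem zmod_pow_sub [Fact (Nat.Prime q)] [Fintype G]
    (hcard : Fintype.card G = q) (a : G) (x y : ZMod q) :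
    a ^ (x - y) = a ^ x / a ^ y := by
  rw [sub_eq_add_neg, zmod_pow_add hcard, zmod_pow_neg hcard, div_eq_mul_inv]

/-- Two accepting transcripts with distinct challenges determine the exponents of the
representation of `A`. -/
theorem prod_zmod_pow_eq_of_transcripts [Fact (Nat.Prime q)] [Fintype G]
    (hcard : Fintype.card G = q) {ι : Type*} [Fintype ι]
    (A b : G) (f : ι → G) {c d : ZMod q} (hne : c ≠ d) (x y : ι → ZMod q) (s t : ZMod q)
    (h : A ^ (-c) * (∏ i, f i ^ x i) * b ^ (-s) = A ^ (-d) * (∏ i, f i ^ y i) * b ^ (-t)) :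
    ∏ i, f i ^ ((x i - y i) / (c - d)) = b ^ ((s - t) / (c - d)) * A := by
  have key : ∏ i, f i ^ (x i - y i) = b ^ (s - t) * A ^ (c - d) := by
    simp only [zmod_pow_sub hcard, zmod_pow_neg hcard, Finset.prod_div_distrib] at h ⊢
    generalize A ^ c = p at *
    generalize A ^ d = p' at *
    generalize ∏ i, f i ^ x i = X at *
    generalize ∏ i, f i ^ y i = Y at *
    generalize b ^ s = S at *
    generalize b ^ t = T at *
    have hX : X = p * (p'⁻¹ * Y * T⁻¹) * S := by
      rw [← h, mul_assoc p⁻¹, mul_inv_cancel_left, inv_mul_cancel_right]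
    rw [hX, div_eq_iff_eq_mul]
    simp only [div_eq_mul_inv]
    ac_rfl
  simp only [div_eq_mul_inv, zmod_pow_mul hcard]
  rw [← zmod_prod_pow, key, zmod_mul_pow, ← zmod_pow_mul hcard A,
    mul_inv_cancel₀ (sub_ne_zero.mpr hne), zmod_pow_one]

end ZModPow

theorem stmt_9 {q : ℕ} [Fact (Nat.Prime q)] {G : Type*} [CommGroup G] [Fintype G]
    (hcard : Fintype.card G = q) {N w : ℕ} (g pk : G)
    (e e' : Fin N → Fin w → G × G) (t₄ : Fin w → G × G)
    (u : Fin N → ZMod q) (c cstar : ZMod q)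
    (s' s'star : Fin N → ZMod q) (s₄ s₄star : Fin w → ZMod q)
    (hne : c ≠ cstar)
    (h1 : t₄ = ReEncV g pk ((∏ i, e i ^ u i) ^ (-c) * ∏ i, e' i ^ s' i) (-s₄))
    (h2 : t₄ = ReEncV g pk ((∏ i, e i ^ u i) ^ (-cstar) * ∏ i, e' i ^ s'star i) (-s₄star)) :
    ∏ i, e' i ^ ((s' i - s'star i) / (c - cstar)) =
      EncV g pk 1 (fun k => (s₄ k - s₄star k) / (c - cstar)) * ∏ i, e i ^ u i := by
  have h := h1.symm.trans h2
  funext k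
  have hk := congrFun h k
  ext
  · have := prod_zmod_pow_eq_of_transcripts hcard (∏ i, (e i k).1 ^ u i) g
      (fun i => (e' i k).1) hne s' s'star (s₄ k) (s₄star k)
      (by simpa [ReEncV, EncV, Prod.fst_prod] using congrArg Prod.fst hk)
    simpa [EncV, Prod.fst_prod] using this
  · have := prod_zmod_pow_eq_of_transcripts hcard (∏ i, (e i k).2 ^ u i) pk
      (fun i => (e' i k).2) hne s' s'star (s₄ k) (s₄star k)
      (by simpa [ReEncV, EncV, Prod.snd_prod] using congrArg Prod.snd hk)
    simpa [EncV, Prod.snd_prod] using this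
end
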